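/- Let X be a set and let S be a vector space (under pointwise operations) of real-valued functions on X whose dimension is a finite number m > 0. Assume that S is closed under the pointwise absolute-value operation ψ ↦ |ψ|, and that S is closed under some m-argument operation Π which sends any ψ₁, …, ψₘ ∈ S to a function Π(ψ₁,…,ψₘ) ∈ S that is nonnegative everywhere on X and has exactly the same zeros as the pointwise product ψ₁⋯ψₘ (that is, Π(ψ₁,…,ψₘ)(x) = 0 if and only if ψ₁(x)⋯ψₘ(x) = 0). Then S has a basis e₁, …, eₘ consisting of nonnegative functions whose supports are pairwise disjoint. -/

import Mathlib

/-- A finite-dimensional space of functions has as many points as its dimension at which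
evaluation determines every function in the space. -/
theorem exists_injective_evaluation {K X : Type*} [Field K] (S : Submodule K (X → K))
    [FiniteDimensional K S] :
    ∃ p : Fin (Module.finrank K S) → X,
      Function.Injective (LinearMap.funLeft K K p ∘ₗ S.subtype) := by
  let ev : X → Module.Dual K S := fun x => LinearMap.proj x ∘ₗ S.subtype
  obtain ⟨f, hf, hspan, -⟩ := Submodule.exists_fun_fin_finrank_span_eq K (Set.range ev)
  choose q hq using hf
  have hinj : Function.Injective (LinearMap.funLeft K K q ∘ₗ S.subtype) := by
    rw [← LinearMap.ker_eq_bot, LinearMap.ker_eq_bot']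
    intro ψ hψ
    have hle : Submodule.span K (Set.range f) ≤ LinearMap.ker (Module.Dual.eval K S ψ) := by
      rw [Submodule.span_le]
      rintro _ ⟨i, rfl⟩
      rw [← hq i]
      exact congrFun hψ i
    ext x
    have hx : ev x ∈ Submodule.span K (Set.range f) :=
      hspan.symm ▸ Submodule.subset_span (Set.mem_range_self x)
    exact hle hx
  have hcard : Module.finrank K (Submodule.span K (Set.range ev)) = Module.finrank K S := by
    apply le_antisymm
    · exact (Submodule.finrank_le _).trans_eq Subspace.dual_finrank_eq
    · simpa using LinearMap.finrank_le_finrank_of_injective hinj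
  refine ⟨q ∘ Fin.cast hcard.symm, fun ψ χ h => hinj (funext fun i => ?_)⟩
  simpa using congrFun h (Fin.cast hcard i)

/-- A finite-dimensional space of real functions closed under the pointwise absolute value has a
basis of nonnegative functions with pairwise disjoint supports. -/
theorem exists_basis_nonneg_pairwise_disjoint_support {X : Type*} (S : Submodule ℝ (X → ℝ))
    [FiniteDimensional ℝ S] (habs : ∀ ψ ∈ S, (fun x => |ψ x|) ∈ S) :
    ∃ b : Module.Basis (Fin (Module.finrank ℝ S)) ℝ S,
      (∀ i, ∀ x, 0 ≤ (b i : X → ℝ) x) ∧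
      Pairwise fun i j =>
        Disjoint (Function.support (b i : X → ℝ)) (Function.support (b j : X → ℝ)) := by
  obtain ⟨p, hp⟩ := exists_injective_evaluation S
  let b : Module.Basis (Fin (Module.finrank ℝ S)) ℝ S :=
    Module.Basis.ofEquivFun (LinearEquiv.ofInjectiveOfFinrankEq _ hp (by simp))
  have hb (i j) : (b i : X → ℝ) (p j) = if i = j then 1 else 0 := by
    have h := b.equivFun_self i j
    rw [Module.Basis.equivFun_ofEquivFun] at h
    exact h
  have heq {ψ χ : X → ℝ} (hψ : ψ ∈ S) (hχ : χ ∈ S) (h : ∀ j, ψ (p j) = χ (p j)) : ψ = χ :=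
    congrArg Subtype.val (@hp ⟨ψ, hψ⟩ ⟨χ, hχ⟩ (funext h))
  have hnonneg (i x) : 0 ≤ (b i : X → ℝ) x := by
    have h : (fun x => |(b i : X → ℝ) x|) = b i := by
      refine heq (habs _ (b i).2) (b i).2 fun j => ?_
      rw [hb]
      split_ifs <;> simp
    rw [← h]
    exact abs_nonneg _
  refine ⟨b, hnonneg, fun i j hij => ?_⟩
  have h : (fun x => |((b i : X → ℝ) - b j) x|) = (b i : X → ℝ) + b j := by
    refine heq (habs _ (S.sub_mem (b i).2 (b j).2)) (S.add_mem (b i).2 (b j).2) fun k => ?_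
    simp only [Pi.sub_apply, Pi.add_apply, hb]
    split_ifs with hi hj
    · exact absurd (hi.trans hj.symm) hij
    all_goals simp
  refine Set.disjoint_left.2 fun x hi hj => ?_
  have hi' := (hnonneg i x).lt_of_ne' hi
  have hj' := (hnonneg j x).lt_of_ne' hj
  have hx : |(b i : X → ℝ) x - (b j : X → ℝ) x| = (b i : X → ℝ) x + (b j : X → ℝ) x :=
    congrFun h x
  cases abs_cases ((b i : X → ℝ) x - (b j : X → ℝ) x) <;> linarith

/-- **Lemma A.1 (set-theoretic lemma).** Let `S` be a vector space of real-valued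
functions on a set `X`, of finite dimension `m > 0`, closed under the pointwise
absolute-value operation and under some `m`-argument operation `Π` sending
`ψ₁, …, ψₘ ∈ S` to a nonnegative function in `S` with exactly the same zeros as the
pointwise product `ψ₁⋯ψₘ`.  Then `S` has a basis consisting of nonnegative functions
with pairwise disjoint supports. -/
theorem stmt_0 {X : Type*} (S : Submodule ℝ (X → ℝ)) (m : ℕ) (hm : 0 < m)
    (hdim : Module.finrank ℝ S = m)
    (habs : ∀ ψ ∈ S, (fun x => |ψ x|) ∈ S)
    (Pi : (Fin m → (X → ℝ)) → (X → ℝ))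
    (hPiMem : ∀ ψ : Fin m → (X → ℝ), (∀ i, ψ i ∈ S) → Pi ψ ∈ S)
    (hPiNonneg : ∀ ψ : Fin m → (X → ℝ), (∀ i, ψ i ∈ S) → ∀ x, 0 ≤ Pi ψ x)
    (hPiZeros : ∀ ψ : Fin m → (X → ℝ), (∀ i, ψ i ∈ S) →
      ∀ x, Pi ψ x = 0 ↔ (∏ i, ψ i x) = 0) :
    ∃ b : Module.Basis (Fin m) ℝ S,
      (∀ i, ∀ x, 0 ≤ (b i : X → ℝ) x) ∧
      Pairwise fun i j =>
        Disjoint (Function.support (b i : X → ℝ)) (Function.support (b j : X → ℝ)) := by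
  subst hdim
  have : FiniteDimensional ℝ S := Module.finite_of_finrank_pos hm
  exact exists_basis_nonneg_pairwise_disjoint_support S habs
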